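/- arXiv:2306.12529 — 2 statements merged into one kernel-verified Lean document; each statement's English description precedes it below -/
import Mathlib

section
/- Let A be a Banach algebra with a right identity e such that the subalgebra eA = {e·a : a ∈ A} is commutative and semisimple (its Jacobson radical is zero). Then every Jordan derivation d of A is spectrally infinitesimal, i.e., the spectral radius of d(a) is zero for every a ∈ A. -/
open Filter Topology

section Johnson

set_option linter.unusedSectionVars false

variable {B : Type*} [NormedCommRing B] [NormedAlgebra ℂ B] [CompleteSpace B]

theorem unbdd_of_not_continuous {E : Type*} [NormedAddCommGroup E] [NormedSpace ℂ E]
    (g : E →ₗ[ℂ] ℂ) (hg : ¬ Continuous g) (ε : ℝ) (hε : 0 < ε) (M : ℝ) :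
    ∃ a : E, ‖a‖ ≤ ε ∧ M < ‖g a‖ := by
  by_contra! h
  apply hg
  obtain ⟨C, hC⟩ := LinearMap.bound_of_ball_bound hε M g
    (fun z hz => h z (by simpa using (mem_ball_zero_iff.1 hz).le))
  exact (g.mkContinuous C hC).continuous

theorem norm_prod_mul_le (c : ℕ → B) (hc : ∀ n, ‖c n‖ ≤ 1) (x : B) (i : ℕ) :
    ‖(∏ j ∈ Finset.range i, c j) * x‖ ≤ ‖x‖ := by
  induction i with
  | zero => simp
  | succ i ih =>
    rw [Finset.prod_range_succ, mul_comm _ (c i), mul_assoc]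
    calc _ ≤ ‖c i‖ * ‖(∏ j ∈ Finset.range i, c j) * x‖ := norm_mul_le _ _
      _ ≤ 1 * ‖x‖ := by gcongr; exact hc i
      _ = ‖x‖ := one_mul _

theorem gliding (D : Derivation ℂ B B) (P s a b : ℕ → B) (φ : ℕ → (B →ₐ[ℂ] ℂ))
    (hP : ∀ n, P (n + 1) = P n * (b n * b n)) (hs : ∀ n, s (n + 1) = s n + P n * a n)
    (hφ : ∀ n, φ n (b n) = 0) (ha : ∀ n, ‖a n‖ ≤ (1 / 2) ^ n) (hb : ∀ n, ‖b n‖ ≤ 1)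
    (hbig : ∀ n : ℕ, (n : ℝ) ≤ ‖φ n (D (s (n + 1)))‖) : False := by
  have hb2 : ∀ n, ‖b n * b n‖ ≤ 1 := fun n =>
    (norm_mul_le _ _).trans (mul_le_one₀ (hb n) (norm_nonneg _) (hb n))
  set f : ℕ → ℕ → B := fun k i => (∏ j ∈ Finset.range i, (b (k + j) * b (k + j))) * a (k + i)
    with hf
  have hsum : ∀ k, Summable (f k) := by
    intro k
    refine Summable.of_norm_bounded (g := fun i => (1 / 2 : ℝ) ^ (k + i)) ?_ ?_
    · simp_rw [pow_add]
      exact (summable_geometric_two).mul_left _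
    · intro i
      exact (norm_prod_mul_le (fun j => b (k + j) * b (k + j)) (fun j => hb2 _) _ i).trans (ha _)
  have hT : ∀ k, ∑' i, f k i = a k + b k * b k * ∑' i, f (k + 1) i := by
    intro k
    rw [(hsum k).tsum_eq_zero_add, ← (hsum (k + 1)).tsum_mul_left]
    congr 1
    · simp [hf]
    · congr 1
      ext i
      simp only [hf]
      rw [Finset.prod_range_succ']
      simp only [add_zero, add_assoc, add_comm 1]
      ring
  have hx : ∀ k, s k + P k * ∑' i, f k i = s 0 + P 0 * ∑' i, f 0 i := by
    intro k
    induction k with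
    | zero => rfl
    | succ k ih =>
      rw [← ih, hT k, hs, hP]
      ring
  set x := s 0 + P 0 * ∑' i, f 0 i
  have hle : ∀ n : ℕ, (n : ℝ) ≤ ‖D x‖ * ‖(1 : B)‖ := by
    intro n
    have h1 : φ n (D x) = φ n (D (s (n + 1))) := by
      rw [← hx (n + 1), hP]
      rw [show P n * (b n * b n) * ∑' i, f (n + 1) i = b n * (b n * (P n * ∑' i, f (n + 1) i)) by
        ring]
      simp [hφ]
    calc (n : ℝ) ≤ _ := hbig n
      _ = ‖φ n (D x)‖ := by rw [h1]
      _ ≤ _ := AlgHom.norm_apply_le_self_mul_norm_one _ _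
  obtain ⟨n, hn⟩ := exists_nat_gt (‖D x‖ * ‖(1 : B)‖)
  exact absurd (hle n) (not_le.2 hn)

theorem exists_sep (φ ψ : B →ₐ[ℂ] ℂ) (h : φ ≠ ψ) : ∃ c, φ c = 0 ∧ ψ c = 1 := by
  have : ∃ a, φ a ≠ ψ a := by
    by_contra! h'
    exact h (AlgHom.ext h')
  obtain ⟨a, ha⟩ := this
  refine ⟨(ψ a - φ a)⁻¹ • (a - algebraMap ℂ B (φ a)), ?_, ?_⟩
  · simp
  · have : ψ a - φ a ≠ 0 := sub_ne_zero.2 (Ne.symm ha)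
    simp [this]

theorem exists_split (Φ : Set (B →ₐ[ℂ] ℂ)) (hΦ : Φ.Infinite) :
    ∃ φ ∈ Φ, ∃ b : B, φ b = 0 ∧ ‖b‖ ≤ 1 ∧ {χ ∈ Φ | χ b ≠ 0}.Infinite := by
  have key : ∃ φ ∈ Φ, ∃ b : B, φ b = 0 ∧ {χ ∈ Φ | χ b ≠ 0}.Infinite := by
    obtain ⟨φ, hφ, ψ, hψ, hne⟩ := hΦ.nontrivial
    obtain ⟨c, hc0, hc1⟩ := exists_sep φ ψ hne
    by_cases h : {χ ∈ Φ | χ c ≠ 0}.Infinite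
    · exact ⟨φ, hφ, c, hc0, h⟩
    · refine ⟨ψ, hψ, 1 - c, by simp [hc1], fun hfin => hΦ ?_⟩
      refine ((Set.not_infinite.1 h).union hfin).subset fun χ hχ => ?_
      by_cases h0 : χ c = 0
      · right; exact ⟨hχ, by simp [h0]⟩
      · left; exact ⟨hχ, h0⟩
  obtain ⟨φ, hφ, b, hb, hinf⟩ := key
  have hpos : (0 : ℝ) < 1 + ‖b‖ := by positivity
  have hne : ((1 + ‖b‖ : ℝ) : ℂ) ≠ 0 := by exact_mod_cast hpos.ne'
  refine ⟨φ, hφ, (((1 + ‖b‖ : ℝ) : ℂ)⁻¹) • b, by simp [hb], ?_, ?_⟩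
  · rw [norm_smul, norm_inv, Complex.norm_real, Real.norm_of_nonneg hpos.le,
      inv_mul_le_iff₀ hpos]
    linarith
  · convert hinf using 3 with χ
    rw [map_smul, smul_eq_mul, mul_ne_zero_iff]
    exact and_congr_right fun _ => and_iff_right (inv_ne_zero hne)

theorem finite_discont (D : Derivation ℂ B B) :
    {φ : B →ₐ[ℂ] ℂ | ¬ Continuous (fun a => φ (D a))}.Finite := by
  by_contra hinf
  set Φ0 := {φ : B →ₐ[ℂ] ℂ | ¬ Continuous (fun a => φ (D a))}
  let St := {t : B × B × Set (B →ₐ[ℂ] ℂ) //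
    t.2.2.Infinite ∧ t.2.2 ⊆ Φ0 ∧ ∀ χ ∈ t.2.2, χ t.1 ≠ 0}
  have step : ∀ (n : ℕ) (t : St), ∃ (t' : St) (φ : B →ₐ[ℂ] ℂ) (a b : B),
      t'.1.1 = t.1.1 * (b * b) ∧ t'.1.2.1 = t.1.2.1 + t.1.1 * a ∧ φ b = 0 ∧
      ‖a‖ ≤ (1 / 2) ^ n ∧ ‖b‖ ≤ 1 ∧ (n : ℝ) ≤ ‖φ (D t'.1.2.1)‖ := by
    rintro n ⟨⟨P, s, Φ⟩, h1, h2, h3⟩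
    simp only at h1 h2 h3
    obtain ⟨φ, hφ, b, hb, hb1, hi⟩ := exists_split Φ h1
    have hd : ¬ Continuous (φ.toLinearMap ∘ₗ D.toLinearMap) := h2 hφ
    have hP := h3 φ hφ
    have hP' : 0 < ‖φ P‖ := norm_pos_iff.2 hP
    obtain ⟨a, ha, hbig⟩ := unbdd_of_not_continuous _ hd ((1 / 2) ^ n) (by positivity)
      ((n + ‖φ (D s)‖ + ‖φ (D P)‖ * ((1 / 2) ^ n * ‖(1 : B)‖)) / ‖φ P‖)
    refine ⟨⟨(P * (b * b), s + P * a, {χ ∈ Φ | χ b ≠ 0}), hi, fun χ hχ => h2 hχ.1, ?_⟩,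
      φ, a, b, rfl, rfl, hb, ha, hb1, ?_⟩
    · intro χ hχ
      simp only [map_mul]
      exact mul_ne_zero (h3 χ hχ.1) (mul_ne_zero hχ.2 hχ.2)
    · simp only
      have hbig' : _ < ‖φ (D a)‖ := hbig
      rw [div_lt_iff₀ hP'] at hbig'
      have e1 : φ (D (s + P * a)) = φ P * φ (D a) + (φ (D s) + φ a * φ (D P)) := by
        simp; ring
      have e2 : ‖φ a * φ (D P)‖ ≤ ‖φ (D P)‖ * ((1 / 2) ^ n * ‖(1 : B)‖) := by
        rw [norm_mul, mul_comm]
        gcongr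
        exact (AlgHom.norm_apply_le_self_mul_norm_one φ a).trans (by gcongr)
      have e3 := norm_sub_le_norm_add (φ P * φ (D a)) (φ (D s) + φ a * φ (D P))
      have e4 := norm_add_le (φ (D s)) (φ a * φ (D P))
      rw [e1]
      rw [norm_mul] at e3
      linarith
  choose nx φ a b h using step
  let t0 : St := ⟨(1, 0, Φ0), hinf, subset_rfl, fun χ _ => by simp⟩
  let t : ℕ → St := fun n => Nat.rec t0 (fun n t => nx n t) n
  have ht : ∀ n, t (n + 1) = nx n (t n) := fun n => rfl
  refine gliding D (fun n => (t n).1.1) (fun n => (t n).1.2.1) (fun n => a n (t n))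
    (fun n => b n (t n)) (fun n => φ n (t n)) ?_ ?_ ?_ ?_ ?_ ?_ <;> intro n
  · exact (h n (t n)).1
  · exact (h n (t n)).2.1
  · exact (h n (t n)).2.2.1
  · exact (h n (t n)).2.2.2.1
  · exact (h n (t n)).2.2.2.2.1
  · exact (h n (t n)).2.2.2.2.2

theorem algHom_cont (φ : B →ₐ[ℂ] ℂ) : Continuous φ :=
  (φ.toLinearMap.mkContinuous ‖(1 : B)‖ (fun x => by
    rw [mul_comm]; exact AlgHom.norm_apply_le_self_mul_norm_one φ x)).continuous

theorem johnson_cont (hss : ∀ b : B, (∀ φ : B →ₐ[ℂ] ℂ, φ b = 0) → b = 0)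
    (D : Derivation ℂ B B) : Continuous D := by
  have hfin := finite_discont D
  set F := {φ : B →ₐ[ℂ] ℂ | ¬ Continuous (fun a => φ (D a))} with hF
  refine LinearMap.continuous_of_seq_closed_graph (g := D.toLinearMap) ?_
  intro u x y hu hDu
  by_contra hne
  have hne' : y - D x ≠ 0 := sub_ne_zero.2 hne
  have hy : ∀ ψ : B →ₐ[ℂ] ℂ, ψ ∉ F → ψ (y - D x) = 0 := by
    intro ψ hψ
    have hc : Continuous (fun a => ψ (D a)) := by simpa [hF] using hψ
    have l1 := (hc.tendsto x).comp hu
    have l2 := ((algHom_cont ψ).tendsto y).comp hDu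
    rw [map_sub, sub_eq_zero]
    exact tendsto_nhds_unique l2 l1
  obtain ⟨φ, hφ⟩ : ∃ φ : B →ₐ[ℂ] ℂ, φ (y - D x) ≠ 0 := by
    by_contra! h
    exact hne' (hss _ h)
  have hφF : φ ∈ F := by
    by_contra h
    exact hφ (hy φ h)
  classical
  have hc : ∀ ψ : B →ₐ[ℂ] ℂ, ∃ c : B, φ c = 1 ∧ (ψ ≠ φ → ψ c = 0) := by
    intro ψ
    by_cases h : ψ = φ
    · exact ⟨1, by simp, fun h' => absurd h h'⟩
    · obtain ⟨c, h0, h1⟩ := exists_sep ψ φ h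
      exact ⟨c, h1, fun _ => h0⟩
  choose c hc1 hc0 using hc
  obtain ⟨z, hz1, hz0⟩ : ∃ z : B, φ z = 1 ∧ ∀ ψ : B →ₐ[ℂ] ℂ, ψ ≠ φ → ψ z = 0 := by
    refine ⟨(φ (y - D x))⁻¹ • ((y - D x) * ∏ ψ ∈ hfin.toFinset, c ψ), ?_, ?_⟩
    · rw [map_smul, map_mul, map_prod]
      simp only [hc1, Finset.prod_const_one, mul_one, smul_eq_mul]
      exact inv_mul_cancel₀ hφ
    · intro ψ hψ
      rw [map_smul, map_mul]
      by_cases h : ψ ∈ F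
      · rw [map_prod, Finset.prod_eq_zero (i := ψ) (by simpa using h) (hc0 ψ hψ)]
        simp
      · rw [hy ψ h]; simp
  have hza : ∀ a, a * z = φ a • z := by
    intro a
    rw [← sub_eq_zero]
    apply hss
    intro ψ
    by_cases h : ψ = φ
    · subst h; simp
    · simp [hz0 ψ h]
  have hzz : z * z = z := by rw [hza, hz1, one_smul]
  have hDz : D z = 0 := by
    have h1 : D z = z * D z + z * D z := by
      conv_lhs => rw [← hzz]
      simp
    have h2 : z * D z = z * D z + z * D z := by
      conv_lhs => rw [h1]
      rw [mul_add, ← mul_assoc, hzz]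
    have h3 : z * D z = 0 := by simpa using h2
    rw [h1, h3, add_zero]
  apply hφF
  have : (fun a => φ (D a)) = fun _ => 0 := by
    ext a
    have h1 := congrArg D (hza a)
    rw [Derivation.leibniz, hDz, Derivation.map_smul, hDz] at h1
    have h2 := congrArg φ h1
    simpa [hz1] using h2
  rw [this]
  exact continuous_const

theorem iter_formula (D : Derivation ℂ B B) (φ : B →ₐ[ℂ] ℂ) (a : B) (ha : φ a = 0) (n : ℕ) :
    ∀ x, φ (D^[n] (a ^ n * x)) = n.factorial * φ (D a) ^ n * φ x := by
  have hadd : ∀ n x y, D^[n] (x + y) = D^[n] x + D^[n] y := fun n x y =>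
    iterate_map_add D n x y
  induction n with
  | zero => simp
  | succ n ih =>
    intro x
    have e : D (a ^ (n + 1) * x) = a ^ n * (((n + 1 : ℕ) : B) * (D a * x)) + a ^ n * (a * D x) := by
      rw [Derivation.leibniz, Derivation.leibniz_pow]
      simp only [smul_eq_mul, nsmul_eq_mul, Nat.add_sub_cancel]
      ring
    rw [Function.iterate_succ_apply, e, hadd, map_add, ih, ih]
    simp only [map_mul, map_natCast, ha, Nat.factorial_succ]
    push_cast
    ring

theorem johnson (hss : ∀ b : B, (∀ φ : B →ₐ[ℂ] ℂ, φ b = 0) → b = 0)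
    (D : Derivation ℂ B B) (x : B) : D x = 0 := by
  have hc := johnson_cont hss D
  let L : B →L[ℂ] B := ⟨D.toLinearMap, hc⟩
  have hL : ∀ x, ‖D x‖ ≤ ‖L‖ * ‖x‖ := fun x => L.le_opNorm x
  apply hss
  intro φ
  set a := x - algebraMap ℂ B (φ x) with ha_def
  have ha : φ a = 0 := by simp [ha_def]
  have hDa : D a = D x := by simp [ha_def]
  rw [← hDa]
  have hiter : ∀ n y, ‖D^[n] y‖ ≤ ‖L‖ ^ n * ‖y‖ := by
    intro n
    induction n with
    | zero => simp
    | succ n ih =>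
      intro y
      rw [Function.iterate_succ_apply']
      calc _ ≤ ‖L‖ * ‖D^[n] y‖ := hL _
        _ ≤ ‖L‖ * (‖L‖ ^ n * ‖y‖) := by gcongr; exact ih y
        _ = _ := by ring
  have hpow : ∀ n, ‖a ^ n * 1‖ ≤ ‖a‖ ^ n * ‖(1 : B)‖ := by
    intro n
    induction n with
    | zero => simp
    | succ n ih =>
      rw [pow_succ', mul_assoc]
      calc _ ≤ ‖a‖ * ‖a ^ n * 1‖ := norm_mul_le _ _
        _ ≤ ‖a‖ * (‖a‖ ^ n * ‖(1 : B)‖) := by gcongr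
        _ = _ := by ring
  by_contra h0
  have hpos : 0 < ‖φ (D a)‖ := norm_pos_iff.2 h0
  have hbd : ∀ n : ℕ, 1 ≤ (‖L‖ * ‖a‖ / ‖φ (D a)‖) ^ n / n.factorial * (‖(1 : B)‖ * ‖(1 : B)‖) := by
    intro n
    have h1 := congrArg norm (iter_formula D φ a ha n 1)
    rw [map_one, mul_one (_ * _), norm_mul, norm_pow, Complex.norm_natCast] at h1
    have h2 : (n.factorial : ℝ) * ‖φ (D a)‖ ^ n
        ≤ (‖L‖ ^ n * (‖a‖ ^ n * ‖(1 : B)‖)) * ‖(1 : B)‖ := by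
      rw [← h1]
      refine (AlgHom.norm_apply_le_self_mul_norm_one φ _).trans ?_
      gcongr
      exact (hiter n _).trans (by gcongr; exact hpow n)
    have h3 : (0 : ℝ) < n.factorial := by exact_mod_cast n.factorial_pos
    have h4 : (0 : ℝ) < n.factorial * ‖φ (D a)‖ ^ n := by positivity
    rw [div_pow, mul_pow, div_div, div_mul_eq_mul_div, le_div_iff₀ (by positivity)]
    linarith
  have hlim := (FloorSemiring.tendsto_pow_div_factorial_atTop
    (‖L‖ * ‖a‖ / ‖φ (D a)‖)).mul_const (‖(1 : B)‖ * ‖(1 : B)‖)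
  have := ge_of_tendsto' hlim hbd
  simp at this
  linarith

theorem ss_of_jacobson (h : (⊥ : Ideal B).jacobson = ⊥) (b : B)
    (hb : ∀ φ : B →ₐ[ℂ] ℂ, φ b = 0) : b = 0 := by
  rw [← Ideal.mem_bot, ← h, Ideal.mem_jacobson_iff]
  intro y
  have hu : IsUnit (y * b + 1) := by
    by_contra hn
    obtain ⟨f, hf⟩ := WeakDual.CharacterSpace.exists_apply_eq_zero hn
    have := hb (WeakDual.CharacterSpace.equivAlgHom f)
    have h' : f b = 0 := this
    simp [h'] at hf
  obtain ⟨z, hz⟩ := hu.exists_left_inv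
  refine ⟨z, ?_⟩
  rw [Ideal.mem_bot, mul_assoc, sub_eq_zero, ← hz]
  ring

end Johnson

theorem spectralRadius_zero_of_sq {R : Type*} [Ring R] [Algebra ℂ R] (x : R) (hx : x * x = 0) :
    spectralRadius ℂ x = 0 := by
  rw [spectralRadius]
  simp only [ENNReal.iSup_eq_zero, ENNReal.coe_eq_zero, nnnorm_eq_zero]
  intro k hk
  by_contra hk0
  apply hk
  rw [spectrum.mem_resolventSet_iff]
  have hcm : algebraMap ℂ R k * x = x * algebraMap ℂ R k := Algebra.commutes k x
  have hinv : algebraMap ℂ R (k⁻¹ ^ 2) * (algebraMap ℂ R k * algebraMap ℂ R k) = 1 := by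
    rw [← map_mul, ← map_mul, ← map_one (algebraMap ℂ R)]
    congr 1
    field_simp
  have h1 : (algebraMap ℂ R k - x) * (algebraMap ℂ R k + x)
      = algebraMap ℂ R k * algebraMap ℂ R k := by
    rw [sub_mul, mul_add, mul_add, hx, hcm]; abel
  have h2 : (algebraMap ℂ R k + x) * (algebraMap ℂ R k - x)
      = algebraMap ℂ R k * algebraMap ℂ R k := by
    rw [add_mul, mul_sub, mul_sub, hx, hcm]; abel
  refine ⟨⟨algebraMap ℂ R k - x, algebraMap ℂ R (k⁻¹ ^ 2) * (algebraMap ℂ R k + x), ?_, ?_⟩, rfl⟩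
  · rw [← mul_assoc, ← Algebra.commutes, mul_assoc, h1, hinv]
  · rw [mul_assoc, h2, hinv]



/-- The subalgebra `eA = {e * a : a ∈ A}` of a non-unital algebra `A`. -/
def eSub {A : Type*} [NonUnitalNormedRing A] [NormedSpace ℂ A]
    [IsScalarTower ℂ A A] [SMulCommClass ℂ A A] (e : A) : NonUnitalSubalgebra ℂ A where
  carrier := Set.range (fun a => e * a)
  add_mem' := by rintro x y ⟨a, rfl⟩ ⟨b, rfl⟩; exact ⟨a + b, mul_add e a b⟩
  mul_mem' := by rintro x y ⟨a, rfl⟩ ⟨b, rfl⟩; exact ⟨a * (e * b), (mul_assoc e a (e * b)).symm⟩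
  smul_mem' := by rintro c x ⟨a, rfl⟩; exact ⟨c • a, mul_smul_comm c e a⟩
  zero_mem' := ⟨0, mul_zero e⟩

/-- When `e` is a right identity of `A`, the subalgebra `eA` is a unital ring with
identity element `e`. -/
def eRing {A : Type*} [NonUnitalNormedRing A] [NormedSpace ℂ A]
    [IsScalarTower ℂ A A] [SMulCommClass ℂ A A] (e : A) (he : ∀ a : A, a * e = a) :
    Ring (eSub e) :=
  { (inferInstance : NonUnitalRing (eSub e)) with
    one := ⟨e, e, he e⟩
    one_mul := by
      rintro ⟨x, a, rfl⟩
      ext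
      show e * (e * a) = e * a
      rw [← mul_assoc, he e]
    mul_one := by
      rintro ⟨x, a, rfl⟩
      ext
      show (e * a) * e = e * a
      rw [he] }

/-- Let `A` be a complex Banach algebra with a right identity `e` such that
the subalgebra `eA` is commutative and semisimple (its Jacobson radical is zero).  Then every
Jordan derivation `d` of `A` is spectrally infinitesimal: the spectral radius of `d a`
(computed in the unitization of `A`) is zero for every `a ∈ A`. -/
theorem jordanDerivation_spectrally_infinitesimal
    {A : Type*} [NonUnitalNormedRing A] [NormedSpace ℂ A]
    [IsScalarTower ℂ A A] [SMulCommClass ℂ A A] [CompleteSpace A]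
    (e : A) (he : ∀ a : A, a * e = a)
    (hcomm : ∀ a b : A, (e * a) * (e * b) = (e * b) * (e * a))
    (hss : letI : Ring (eSub e) := eRing e he
           (⊥ : Ideal (eSub e)).jacobson = ⊥)
    (d : A →ₗ[ℂ] A) (hd : ∀ a : A, d (a * a) = d a * a + a * d a) :
    ∀ a : A, spectralRadius ℂ ((d a : A) : Unitization ℂ A) = 0 := by
  
  have hee : ∀ x : A, e * (e * x) = e * x := fun x => by rw [← mul_assoc, he]
  have hmem : ∀ x : A, x ∈ eSub e ↔ e * x = x := by
    intro x
    constructor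
    · rintro ⟨a, rfl⟩
      exact hee a
    · intro h
      exact ⟨x, h⟩
  -- `e` acts as a left identity after any factor
  have hle : ∀ x y : A, x * (e * y) = x * y := fun x y => by rw [← mul_assoc, he]
  have hlin : ∀ a b : A, d (a * b) + d (b * a) = d a * b + a * d b + (d b * a + b * d a) := by
    intro a b
    have h := hd (a + b)
    have h1 : (a + b) * (a + b) = a * a + b * b + (a * b + b * a) := by
      rw [add_mul, mul_add, mul_add]; abel
    rw [h1, map_add, map_add, hd, hd, map_add, map_add, add_mul, mul_add, mul_add, add_mul,
      mul_add, mul_add] at h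
    have h2 : d (a * b) + d (b * a) = (d a * a + a * d a + (d b * b + b * d b) +
      (d (a * b) + d (b * a))) - (d a * a + a * d a + (d b * b + b * d b)) := by abel
    rw [h2, h]
    abel
  have hcl : IsClosed ((eSub e : NonUnitalSubalgebra ℂ A) : Set A) := by
    have : ((eSub e : NonUnitalSubalgebra ℂ A) : Set A) = {x | e * x = x} := by
      ext x; exact hmem x
    rw [this]
    exact isClosed_eq (continuous_const.mul continuous_id) continuous_id
  letI iR : NormedCommRing (eSub e) :=
    { (inferInstance : NonUnitalNormedRing (eSub e)) with
      one := (eRing e he).one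
      one_mul := (eRing e he).one_mul
      mul_one := (eRing e he).mul_one
      mul_comm := by
        rintro ⟨x, a, rfl⟩ ⟨y, b, rfl⟩
        exact Subtype.ext (hcomm a b) }
  letI iA : NormedAlgebra ℂ (eSub e) :=
    { Algebra.ofModule (R := ℂ) (A := eSub e)
        (fun r x y => smul_mul_assoc r x y) (fun r x y => mul_smul_comm r x y) with
      norm_smul_le := fun r x => norm_smul_le r (x : A) }
  haveI iC : CompleteSpace (eSub e) := hcl.completeSpace_coe
  have hss' := ss_of_jacobson (B := eSub e) hss
  let D0 : eSub e →ₗ[ℂ] eSub e :=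
    { toFun := fun x => ⟨e * d x, d x, rfl⟩
      map_add' := fun x y => Subtype.ext (by
        show e * d ((x : A) + y) = e * d x + e * d y
        rw [map_add, mul_add])
      map_smul' := fun r x => Subtype.ext (by
        show e * d (r • (x : A)) = r • (e * d x)
        rw [map_smul, mul_smul_comm]) }
  have hleib : ∀ x y : eSub e, D0 (x * y) = x • D0 y + y • D0 x := by
    intro x y
    have hxe : e * (x : A) = x := (hmem _).1 x.2
    have hye : e * (y : A) = y := (hmem _).1 y.2
    have hxy : (x : A) * y = y * x := by
      have := hcomm x y
      rwa [hxe, hye] at this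
    have h := congrArg (fun t => e * t) (hlin x y)
    simp only [mul_add, ← hxy] at h
    have c1 : e * (d x * y) = y * (e * d x) := by
      have := hcomm (d x) y
      rw [hye, mul_assoc] at this
      exact this
    have c2 : e * (d y * x) = x * (e * d y) := by
      have := hcomm (d y) x
      rw [hxe, mul_assoc] at this
      exact this
    have c3 : e * (x * d y) = x * (e * d y) := by rw [← mul_assoc, hxe, hle]
    have c4 : e * (y * d x) = y * (e * d x) := by rw [← mul_assoc, hye, hle]
    rw [c1, c2, c3, c4] at h
    apply Subtype.ext
    show e * d ((x : A) * y) = x * (e * d y) + y * (e * d x)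
    have h' : (2 : ℂ) • (e * d ((x : A) * y)) = (2 : ℂ) • (x * (e * d y) + y * (e * d x)) := by
      rw [two_smul, two_smul, h]; abel
    exact smul_right_injective A (two_ne_zero (α := ℂ)) h'
  let D : Derivation ℂ (eSub e) (eSub e) := Derivation.mk' D0 hleib
  have hD : ∀ a : A, e * d (e * a) = 0 := by
    intro a
    have := johnson hss' D ⟨e * a, a, rfl⟩
    exact congrArg Subtype.val this
  have hN : ∀ n : A, e * n = 0 → e * d n = 0 := by
    intro n hn
    have h := congrArg (fun t => e * t) (hlin n e)
    have z1 : d e * n = 0 := by rw [← hle, hn, mul_zero]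
    have z2 : e * (n * d e) = 0 := by rw [← mul_assoc, hn, zero_mul]
    simp only [he, hn, map_zero, add_zero, mul_add, z1, z2, mul_zero, zero_add, hee] at h
    simpa using h
  intro a
  have hz : e * d a = 0 := by
    have h1 := hD a
    have h2 := hN (a - e * a) (by rw [mul_sub, hee, sub_self])
    rw [map_sub, mul_sub, h1, sub_zero] at h2
    exact h2
  have hsq : d a * d a = 0 := by rw [← hle, hz, mul_zero]
  apply spectralRadius_zero_of_sq
  rw [← Unitization.inr_mul, hsq, Unitization.inr_zero]
end

section
/- Let A be a Banach algebra with a right identity e such that the subalgebra eA = {e·a : a ∈ A} is commutative and semisimple (its Jacobson radical is zero). If d₁ and d₂ are two Jordan derivations of A, then the composition d₁∘d₂ is a derivation of A. -/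
open Filter Topology

theorem jd_tail {B : Type*} [NormedCommRing B] [CompleteSpace B] (c b : ℕ → B)
    (hc : ∀ i, ‖c i‖ ≤ 1) (hb : ∀ i, ‖b i‖ ≤ (1 / 2 : ℝ) ^ i) :
    ∃ y : ℕ → B, ∀ n, y n = b n + c n ^ 2 * y (n + 1) := by
  have key : ∀ n k, ‖(∏ i ∈ Finset.range k, c (n + i) ^ 2) * b (n + k)‖ ≤ (1 / 2 : ℝ) ^ k := by
    intro n k
    have h1 : ∀ k z, ‖(∏ i ∈ Finset.range k, c (n + i) ^ 2) * z‖ ≤ ‖z‖ := by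
      intro k
      induction k with
      | zero => intro z; simp
      | succ k ih =>
        intro z
        rw [Finset.prod_range_succ, mul_assoc]
        refine (ih _).trans ?_
        have h2 : ‖c (n + k) * z‖ ≤ ‖z‖ :=
          (norm_mul_le _ _).trans (mul_le_of_le_one_left (norm_nonneg _) (hc _))
        rw [pow_two, mul_assoc]
        exact ((norm_mul_le _ _).trans (mul_le_of_le_one_left (norm_nonneg _) (hc _))).trans h2
    refine (h1 k _).trans ((hb _).trans ?_)
    exact pow_le_pow_of_le_one (by norm_num) (by norm_num) (by omega)
  have hs : ∀ n, Summable fun k => (∏ i ∈ Finset.range k, c (n + i) ^ 2) * b (n + k) := fun n =>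
    Summable.of_norm_bounded (summable_geometric_of_lt_one (by norm_num) (by norm_num)) (key n)
  refine ⟨fun n => ∑' k, (∏ i ∈ Finset.range k, c (n + i) ^ 2) * b (n + k), fun n => ?_⟩
  dsimp only
  rw [(hs n).tsum_eq_zero_add, ← (hs (n + 1)).tsum_mul_left]
  congr 1
  · simp
  · refine tsum_congr fun k => ?_
    rw [Finset.prod_range_succ']
    simp only [add_zero, Nat.add_assoc, Nat.add_comm 1]
    ring

theorem jd_separate {B : Type*} [NormedCommRing B] [NormedAlgebra ℂ B] [CompleteSpace B]
    (φ : ℕ → B →ₐ[ℂ] ℂ) (hφ : Function.Injective φ) :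
    ∃ d : B, ∀ m n, m ≠ n → φ m d ≠ φ n d := by
  have hcont : ∀ n, Continuous (φ n) := fun n => map_continuous (φ n)
  have := dense_iInter_of_isOpen
    (f := fun p : {p : ℕ × ℕ // p.1 ≠ p.2} => {d : B | φ p.1.1 d ≠ φ p.1.2 d})
    (fun p => isOpen_ne_fun (hcont _) (hcont _)) (by
      rintro ⟨⟨m, n⟩, hmn⟩
      let K : Submodule ℂ B := LinearMap.ker ((φ m).toLinearMap - (φ n).toLinearMap)
      have hK : {d : B | φ m d ≠ φ n d} = (K : Set B)ᶜ := by
        ext d; simp [K, sub_eq_zero]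
      show Dense {d : B | φ m d ≠ φ n d}
      rw [hK, ← interior_eq_empty_iff_dense_compl]
      by_contra hne
      have := K.eq_top_of_nonempty_interior' (Set.nonempty_iff_ne_empty.2 hne)
      apply hmn
      apply hφ
      ext d
      have hd : d ∈ K := by rw [this]; trivial
      simpa [K, sub_eq_zero] using hd)
  obtain ⟨d, hd⟩ := this.nonempty
  exact ⟨d, fun m n h => by simpa using Set.mem_iInter.1 hd ⟨(m, n), h⟩⟩

theorem jd_finite {B : Type*} [NormedCommRing B] [NormedAlgebra ℂ B] [CompleteSpace B]
    (D : B →ₗ[ℂ] B) (hD : ∀ a b, D (a * b) = D a * b + a * D b) :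
    {φ : B →ₐ[ℂ] ℂ | ¬ ∃ C : ℝ, ∀ b, ‖φ (D b)‖ ≤ C * ‖b‖}.Finite := by
  by_contra hinf
  have hinf' : Set.Infinite {φ : B →ₐ[ℂ] ℂ | ¬ ∃ C : ℝ, ∀ b, ‖φ (D b)‖ ≤ C * ‖b‖} := hinf
  let ι := hinf'.natEmbedding
  let φ : ℕ → B →ₐ[ℂ] ℂ := fun n => (ι n).1
  have hφ : Function.Injective φ := Subtype.val_injective.comp ι.injective
  have hun : ∀ n, ¬ ∃ C : ℝ, ∀ b, ‖φ n (D b)‖ ≤ C * ‖b‖ := fun n => (ι n).2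
  obtain ⟨d, hd⟩ := jd_separate φ hφ
  have hc : ∀ n, ∃ c : B, ‖c‖ ≤ 1 ∧ φ n c = 0 ∧ ∀ m, m ≠ n → φ m c ≠ 0 := by
    intro n
    let c := d - algebraMap ℂ B (φ n d)
    have hpos : (0 : ℝ) < ‖c‖ + 1 := by positivity
    refine ⟨(((‖c‖ + 1)⁻¹ : ℝ) : ℂ) • c, ?_, ?_, ?_⟩
    · rw [norm_smul, Complex.norm_real, Real.norm_of_nonneg (by positivity)]
      rw [inv_mul_le_iff₀ hpos]; linarith
    · simp [c]
    · intro m hm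
      rw [map_smul]
      refine smul_ne_zero ?_ ?_
      · exact_mod_cast (inv_pos.2 hpos).ne'
      · simpa [c, sub_eq_zero] using hd m n hm
  choose c hc1 hc0 hcne using hc
  let P : ℕ → B := fun n => ∏ i ∈ Finset.range n, c i ^ 2
  have hP : ∀ n, φ n (P n) ≠ 0 := by
    intro n
    simp only [P, map_prod, map_pow]
    refine Finset.prod_ne_zero_iff.2 fun i hi => pow_ne_zero _ (hcne i n ?_)
    exact (Finset.mem_range.1 hi).ne'
  have hβ : ∀ (n : ℕ) (s : B), ∃ b : B, ‖b‖ ≤ (1 / 2 : ℝ) ^ n ∧ (n : ℝ) ≤ ‖φ n (D (s + P n * b))‖ := by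
    intro n s
    by_contra! hcon
    apply hun n
    have hr : (0 : ℝ) < (1 / 2) ^ n := by positivity
    have hφle := fun a => AlgHom.norm_apply_le_self_mul_norm_one (φ n) a
    refine LinearMap.bound_of_ball_bound (𝕜 := ℂ) hr
      ((n + ‖φ n (D s)‖ + ‖φ n (D (P n))‖ * ((1 / 2) ^ n * ‖(1 : B)‖)) / ‖φ n (P n)‖)
      ((φ n).toLinearMap ∘ₗ D) ?_
    intro z hz
    have hz' : ‖z‖ ≤ (1 / 2 : ℝ) ^ n := by simpa using (mem_ball_zero_iff.1 hz).le
    have h1 := hcon z hz'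
    rw [le_div_iff₀ (norm_pos_iff.2 (hP n))]
    have h2 : φ n (D z) * φ n (P n)
        = φ n (D (s + P n * z)) - φ n (D s) - φ n (D (P n)) * φ n z := by
      simp only [map_add, hD, map_mul]; ring
    have h3 : ‖φ n z‖ ≤ (1 / 2) ^ n * ‖(1 : B)‖ :=
      (hφle z).trans (mul_le_mul_of_nonneg_right hz' (norm_nonneg _))
    show ‖φ n (D z)‖ * ‖φ n (P n)‖ ≤ _
    rw [← norm_mul, h2]
    refine (norm_sub_le _ _).trans (add_le_add ((norm_sub_le _ _).trans ?_) ?_)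
    · linarith
    · rw [norm_mul]; exact mul_le_mul_of_nonneg_left h3 (norm_nonneg _)
  choose β hβ1 hβ2 using hβ
  let s : ℕ → B := fun n => Nat.rec 0 (fun n t => t + P n * β n t) n
  have hs : ∀ n, s (n + 1) = s n + P n * β n (s n) := fun n => rfl
  obtain ⟨y, hy⟩ := jd_tail c (fun n => β n (s n)) hc1 (fun n => hβ1 n _)
  have hx : ∀ n, s n + P n * y n = y 0 := by
    intro n
    induction n with
    | zero => simp [s, P]
    | succ n ih =>
      rw [← ih, hs, hy n]
      simp only [P, Finset.prod_range_succ]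
      ring
  have hbig : ∀ n : ℕ, (n : ℝ) ≤ ‖D (y 0)‖ * ‖(1 : B)‖ := by
    intro n
    have h1 : y 0 = (s n + P n * β n (s n)) + c n * (c n * (P n * y (n + 1))) := by
      rw [← hx n, hy n]; ring
    have h2 : φ n (D (y 0)) = φ n (D (s n + P n * β n (s n))) := by
      rw [h1, map_add D, hD (c n), hD (c n)]
      simp [hc0]
    calc (n : ℝ) ≤ ‖φ n (D (s n + P n * β n (s n)))‖ := hβ2 n _
      _ = ‖φ n (D (y 0))‖ := by rw [h2]
      _ ≤ _ := AlgHom.norm_apply_le_self_mul_norm_one (φ n) _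
  obtain ⟨n, hn⟩ := exists_nat_gt (‖D (y 0)‖ * ‖(1 : B)‖)
  exact absurd (hbig n) (not_le.2 hn)

theorem jd_semisimple {B : Type*} [NormedCommRing B] [NormedAlgebra ℂ B] [CompleteSpace B]
    (hss : (⊥ : Ideal B).jacobson = ⊥) (x : B) (hx : ∀ φ : B →ₐ[ℂ] ℂ, φ x = 0) : x = 0 := by
  have : x ∈ (⊥ : Ideal B).jacobson := by
    rw [Ideal.mem_jacobson_bot]
    intro y
    by_contra h
    obtain ⟨f, hf⟩ := WeakDual.CharacterSpace.exists_apply_eq_zero h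
    have h1 := hx (WeakDual.CharacterSpace.toAlgHom f)
    have h2 : WeakDual.CharacterSpace.toAlgHom f (x * y + 1) = 0 := hf
    rw [map_add, map_mul, h1, map_one] at h2
    simp at h2
  rw [hss] at this
  simpa using this

theorem jd_continuous {B : Type*} [NormedCommRing B] [NormedAlgebra ℂ B] [CompleteSpace B]
    (hss : (⊥ : Ideal B).jacobson = ⊥)
    (D : B →ₗ[ℂ] B) (hD : ∀ a b, D (a * b) = D a * b + a * D b) : Continuous D := by
  classical
  refine D.continuous_of_seq_closed_graph fun u x z hu hDu => ?_
  have hv : Tendsto (fun n => u n - x) atTop (𝓝 0) := by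
    simpa using hu.sub_const x
  have hDv : Tendsto (fun n => D (u n - x)) atTop (𝓝 (z - D x)) := by
    simpa using! hDu.sub_const (D x)
  rw [← sub_eq_zero]
  set s := z - D x with hsdef
  clear_value s
  refine jd_semisimple hss s fun φ => ?_
  by_contra hφs
  let F := (jd_finite D hD).toFinset
  have hφc : ∀ χ : B →ₐ[ℂ] ℂ, Tendsto (fun n => χ (D (u n - x))) atTop (𝓝 (χ s)) := fun χ =>
    ((map_continuous χ).tendsto s).comp hDv
  have hF : ∀ χ : B →ₐ[ℂ] ℂ, χ ∉ F → χ s = 0 := by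
    intro χ hχ
    simp only [F, Set.Finite.mem_toFinset, Set.mem_ofPred_eq, not_not] at hχ
    obtain ⟨C, hC⟩ := hχ
    refine tendsto_nhds_unique (hφc χ) (squeeze_zero_norm (fun n => hC _) ?_)
    simpa using hv.norm.const_mul C
  have hsep : ∀ χ : B →ₐ[ℂ] ℂ, ∃ d : B, χ d = 0 ∧ (χ ≠ φ → φ d ≠ 0) := by
    intro χ
    by_cases h : χ = φ
    · exact ⟨0, by simp, fun h' => absurd h h'⟩
    · have : ∃ d, χ d ≠ φ d := by
        by_contra! hc
        exact h (AlgHom.ext hc)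
      obtain ⟨d, hd⟩ := this
      refine ⟨d - algebraMap ℂ B (χ d), by simp, fun _ => ?_⟩
      simpa [sub_eq_zero] using hd.symm
  choose d hd0 hd1 using hsep
  let q := s * ∏ χ ∈ F.erase φ, d χ
  have hq : φ q ≠ 0 := by
    simp only [q, map_mul, map_prod]
    exact mul_ne_zero hφs (Finset.prod_ne_zero_iff.2 fun χ hχ => hd1 χ (Finset.ne_of_mem_erase hχ))
  have hq0 : ∀ χ : B →ₐ[ℂ] ℂ, χ ≠ φ → χ q = 0 := by
    intro χ hχ
    simp only [q, map_mul, map_prod]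
    by_cases h : χ ∈ F
    · rw [Finset.prod_eq_zero (Finset.mem_erase.2 ⟨hχ, h⟩) (hd0 χ), mul_zero]
    · rw [hF χ h, zero_mul]
  let p := (φ q)⁻¹ • q
  have hp1 : φ p = 1 := by simp [p, hq]
  have hp0 : ∀ χ : B →ₐ[ℂ] ℂ, χ ≠ φ → χ p = 0 := fun χ hχ => by simp [p, hq0 χ hχ]
  have hpb : ∀ b, p * b = φ b • p := by
    intro b
    rw [← sub_eq_zero]
    refine jd_semisimple hss _ fun χ => ?_
    by_cases h : χ = φ
    · subst h; simp [hp1]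
    · simp [hp0 χ h]
  have hpp : p * p = p := by rw [hpb, hp1, one_smul]
  have hDp : D p = 0 := by
    have h1 : D p = D p * p + p * D p := by rw [← hD, hpp]
    have h2 : p * D p = 0 := by
      have h3 : p * D p = p * (D p * p + p * D p) := by rw [← h1]
      have h4 : p * (D p * p + p * D p) = p * p * D p + p * p * D p := by ring
      rw [h4, hpp] at h3
      simpa using h3
    rw [h1, mul_comm, h2, add_zero]
  have hz : ∀ b, φ (D b) = 0 := by
    intro b
    have h1 : D (p * b) = 0 := by rw [hpb, map_smul, hDp, smul_zero]
    rw [hD, hDp, zero_mul, zero_add] at h1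
    have := congrArg φ h1
    simpa [hp1] using this
  apply hφs
  refine tendsto_nhds_unique (hφc φ) ?_
  simp [hz]

theorem jd_pow {B : Type*} [CommRing B] [Algebra ℂ B]
    (D : B →ₗ[ℂ] B) (hD : ∀ a b, D (a * b) = D a * b + a * D b) (b : B) (k : ℕ) :
    ∀ m : ℕ, ∃ c : B, D^[k] (b ^ (m + k))
      = ((m + 1).ascFactorial k : B) * D b ^ k * b ^ m + c * b ^ (m + 1) := by
  have hD1 : D 1 = 0 := by
    have := hD 1 1
    simpa using this
  have hDn : ∀ n : ℕ, D (n : B) = 0 := by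
    intro n
    rw [show (n : B) = (n : ℂ) • (1 : B) by rw [Algebra.smul_def]; simp, map_smul, hD1, smul_zero]
  have hpow : ∀ n : ℕ, D (b ^ (n + 1)) = (n + 1) * b ^ n * D b := by
    intro n
    induction n with
    | zero => simp
    | succ n ih => rw [pow_succ, hD, ih]; push_cast; ring
  induction k with
  | zero => intro m; exact ⟨0, by simp⟩
  | succ k ih =>
    intro m
    obtain ⟨c, hc⟩ := ih (m + 1)
    rw [show m + (k + 1) = m + 1 + k by ring, Function.iterate_succ_apply', hc, map_add,
      hD, hD, hDn, hD, hpow, hpow]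
    refine ⟨((m + 1 + 1).ascFactorial k : B) * D (D b ^ k) + D c * b + c * ((m + 1 + 1) * D b), ?_⟩
    have : (m + 1).ascFactorial (k + 1) = (m + 1) * (m + 1 + 1).ascFactorial k :=
      (Nat.succ_ascFactorial (m + 1) k ▸ rfl)
    rw [this]
    push_cast
    ring

theorem jd_johnson {B : Type*} [NormedCommRing B] [NormedAlgebra ℂ B] [CompleteSpace B]
    (hss : (⊥ : Ideal B).jacobson = ⊥)
    (D : B →ₗ[ℂ] B) (hD : ∀ a b, D (a * b) = D a * b + a * D b) (b : B) : D b = 0 := by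
  have hcont := jd_continuous hss D hD
  let T : B →L[ℂ] B := ⟨D, hcont⟩
  have hD1 : D 1 = 0 := by
    have := hD 1 1
    simpa using this
  refine jd_semisimple hss _ fun φ => ?_
  by_contra hne
  let a := b - algebraMap ℂ B (φ b)
  have ha : φ a = 0 := by simp [a]
  have hDa : D a = D b := by
    simp [a, Algebra.algebraMap_eq_smul_one, hD1]
  have hval : ∀ k : ℕ, φ (D^[k] (a ^ k)) = (k.factorial : ℂ) * φ (D b) ^ k := by
    intro k
    obtain ⟨c, hc⟩ := jd_pow D hD a k 0
    rw [zero_add] at hc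
    rw [hc]
    simp [ha, hDa, Nat.one_ascFactorial]
  have hit : ∀ k x, ‖D^[k] x‖ ≤ ‖T‖ ^ k * ‖x‖ := by
    intro k
    induction k with
    | zero => intro x; simp
    | succ k ih =>
      intro x
      rw [Function.iterate_succ_apply', pow_succ', mul_assoc]
      exact (T.le_opNorm _).trans (mul_le_mul_of_nonneg_left (ih x) (norm_nonneg _))
  have hpw : ∀ k : ℕ, ‖a ^ k‖ ≤ ‖a‖ ^ k * ‖(1 : B)‖ := by
    intro k
    induction k with
    | zero => simp
    | succ k ih =>
      rw [pow_succ', pow_succ', mul_assoc]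
      exact (norm_mul_le _ _).trans (mul_le_mul_of_nonneg_left ih (norm_nonneg _))
  have hpos : 0 < ‖φ (D b)‖ := norm_pos_iff.2 hne
  have hle : ∀ k : ℕ, 1 ≤ (‖T‖ * ‖a‖ / ‖φ (D b)‖) ^ k / k.factorial * (‖(1 : B)‖ * ‖(1 : B)‖) := by
    intro k
    have h1 : (k.factorial : ℝ) * ‖φ (D b)‖ ^ k
        ≤ ‖T‖ ^ k * (‖a‖ ^ k * ‖(1 : B)‖) * ‖(1 : B)‖ := by
      have : ‖φ (D^[k] (a ^ k))‖ = (k.factorial : ℝ) * ‖φ (D b)‖ ^ k := by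
        rw [hval]; simp
      rw [← this]
      refine (AlgHom.norm_apply_le_self_mul_norm_one φ _).trans ?_
      refine mul_le_mul_of_nonneg_right ((hit _ _).trans ?_) (norm_nonneg _)
      exact mul_le_mul_of_nonneg_left (hpw k) (by positivity)
    have h2 : (0 : ℝ) < (k.factorial : ℝ) * ‖φ (D b)‖ ^ k := by positivity
    rw [div_pow, mul_pow]
    have h3 : ‖T‖ ^ k * ‖a‖ ^ k / ‖φ (D b)‖ ^ k / k.factorial * (‖(1 : B)‖ * ‖(1 : B)‖)
      = (‖T‖ ^ k * (‖a‖ ^ k * ‖(1 : B)‖) * ‖(1 : B)‖) / ((k.factorial : ℝ) * ‖φ (D b)‖ ^ k) := by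
      field_simp
    rw [h3, one_le_div h2]
    exact h1
  have hlim := (FloorSemiring.tendsto_pow_div_factorial_atTop
    (‖T‖ * ‖a‖ / ‖φ (D b)‖)).mul_const (‖(1 : B)‖ * ‖(1 : B)‖)
  rw [zero_mul] at hlim
  have := ge_of_tendsto' hlim hle
  linarith

/-- `eA` as a commutative normed ring whose ring structure is `eRing`. -/
abbrev jdNCR {A : Type*} [NonUnitalNormedRing A] [NormedSpace ℂ A]
    [IsScalarTower ℂ A A] [SMulCommClass ℂ A A] (e : A) (he : ∀ a : A, a * e = a)
    (hcomm : ∀ a b : A, (e * a) * (e * b) = (e * b) * (e * a)) : NormedCommRing (eSub e) :=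
  { (inferInstance : NonUnitalNormedRing (eSub e)), eRing e he with
    mul_comm := by
      rintro ⟨x, a, rfl⟩ ⟨y, b, rfl⟩
      exact Subtype.ext (hcomm a b) }

theorem jd_corner {A : Type*} [NonUnitalNormedRing A] [NormedSpace ℂ A]
    [IsScalarTower ℂ A A] [SMulCommClass ℂ A A] [CompleteSpace A]
    (e : A) (he : ∀ a : A, a * e = a)
    (hcomm : ∀ a b : A, (e * a) * (e * b) = (e * b) * (e * a))
    (hss : letI : Ring (eSub e) := eRing e he
           (⊥ : Ideal (eSub e)).jacobson = ⊥)
    (d : A →ₗ[ℂ] A)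
    (hd : ∀ a b : A, e * d ((e * a) * (e * b)) = (e * d (e * a)) * (e * b) + (e * a) * (e * d (e * b))) :
    ∀ a, e * d (e * a) = 0 := by
  letI := jdNCR e he hcomm
  letI : NormedAlgebra ℂ (eSub e) :=
    { Algebra.ofModule (R := ℂ) (A := eSub e)
        (fun r x y => by
          exact Subtype.ext (smul_mul_assoc r (x : A) (y : A)))
        (fun r x y => by
          exact Subtype.ext (mul_smul_comm r (x : A) (y : A))) with
      norm_smul_le := fun r x => norm_smul_le r (x : A) }
  have hclosed : IsClosed ((eSub e : NonUnitalSubalgebra ℂ A) : Set A) := by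
    have : ((eSub e : NonUnitalSubalgebra ℂ A) : Set A) = {x | e * x = x} := by
      ext x
      constructor
      · rintro ⟨a, rfl⟩
        show e * (e * a) = e * a
        rw [← mul_assoc, he]
      · intro h
        exact ⟨x, h⟩
    rw [this]
    exact isClosed_eq (continuous_const.mul continuous_id) continuous_id
  haveI : CompleteSpace (eSub e) := hclosed.completeSpace_coe
  let D : eSub e →ₗ[ℂ] eSub e :=
    { toFun := fun x => ⟨e * d x, d x, rfl⟩
      map_add' := fun x y => Subtype.ext (by
        show e * d ((x : A) + (y : A)) = e * d x + e * d y
        rw [map_add, mul_add])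
      map_smul' := fun r x => Subtype.ext (by
        show e * d (r • (x : A)) = r • (e * d x)
        rw [map_smul, mul_smul_comm]) }
  have hD : ∀ x y, D (x * y) = D x * y + x * D y := by
    rintro ⟨x, a, rfl⟩ ⟨y, b, rfl⟩
    exact Subtype.ext (hd a b)
  intro a
  exact congrArg Subtype.val (jd_johnson hss D hD ⟨e * a, a, rfl⟩)

theorem jd_structure {A : Type*} [NonUnitalNormedRing A] [NormedSpace ℂ A]
    [IsScalarTower ℂ A A] [SMulCommClass ℂ A A] [CompleteSpace A]
    (e : A) (he : ∀ a : A, a * e = a)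
    (hcomm : ∀ a b : A, (e * a) * (e * b) = (e * b) * (e * a))
    (hss : letI : Ring (eSub e) := eRing e he
           (⊥ : Ideal (eSub e)).jacobson = ⊥)
    (d : A →ₗ[ℂ] A)
    (hd : ∀ a : A, d (a * a) = d a * a + a * d a) :
    (∀ a, e * d a = 0) ∧ ∀ a x, d (a * x) = d a * x := by
  -- every product absorbs `e` in the middle
  have hmid : ∀ a x : A, a * (e * x) = a * x := fun a x => by rw [← mul_assoc, he]
  have hann : ∀ n : A, e * n = 0 → ∀ a, a * n = 0 := fun n hn a => by
    rw [← hmid, hn, mul_zero]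
  have hpol : ∀ a x : A, d (a * x) + d (x * a) = d a * x + a * d x + (d x * a + x * d a) := by
    intro a x
    have h := hd (a + x)
    simp only [add_mul, mul_add, map_add, hd a, hd x] at h
    have h2 : d (a * x) + d (x * a) - (d a * x + a * d x + (d x * a + x * d a)) = 0 := by
      rw [← sub_eq_zero] at h
      rw [← h]; abel
    exact sub_eq_zero.1 h2
  have hde : e * d e = 0 := by
    have h := hd e
    rw [he, he] at h
    simpa using h
  have hade := hann _ hde
  have hea : ∀ a, d (e * a) = d e * a + e * d a := by
    intro a
    have h := hpol a e
    rw [he, he, hade a, add_zero] at h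
    exact add_left_cancel h
  have hN : ∀ n, e * n = 0 → e * d n = 0 := by
    intro n hn
    have h := hea n
    rw [hn, map_zero, hann n hn, zero_add] at h
    exact h.symm
  have hcor := jd_corner e he hcomm hss d (by
    intro a b
    have h := hpol (e * a) (e * b)
    rw [hcomm b a] at h
    have h2 := congrArg (fun z => e * z) h
    simp only [mul_add] at h2
    have e1 : e * (d (e * a) * (e * b)) = (e * d (e * a)) * (e * b) := (mul_assoc _ _ _).symm
    have e2 : e * (e * a * d (e * b)) = (e * a) * (e * d (e * b)) := by
      rw [hmid, ← mul_assoc, ← mul_assoc, he]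
    have e3 : e * (d (e * b) * (e * a)) = (e * a) * (e * d (e * b)) := by
      rw [← mul_assoc, hcomm]
    have e4 : e * (e * b * d (e * a)) = (e * d (e * a)) * (e * b) := by
      rw [← hcomm b, hmid, ← mul_assoc, ← mul_assoc, he]
    rw [e1, e2, e3, e4] at h2
    have h3 : (2 : ℂ) • (e * d ((e * a) * (e * b)))
        = (2 : ℂ) • ((e * d (e * a)) * (e * b) + (e * a) * (e * d (e * b))) := by
      rw [two_smul, two_smul, h2]; abel
    exact smul_right_injective A (two_ne_zero : (2 : ℂ) ≠ 0) h3)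
  have hsub : ∀ a, e * (a - e * a) = 0 := fun a => by rw [mul_sub, hmid, sub_self]
  have hz : ∀ a, e * d a = 0 := by
    intro a
    have h := hN _ (hsub a)
    rw [map_sub, mul_sub, hcor, sub_zero] at h
    exact h
  refine ⟨hz, fun a x => ?_⟩
  have hea' : ∀ a, d (e * a) = d e * a := fun a => by rw [hea, hz, add_zero]
  have h1 : d ((a - e * a) * x) = d (a - e * a) * x := by
    have h := hpol (a - e * a) (e * x)
    rw [hmid, hann _ (hsub a), map_zero, add_zero, hmid, hann _ (hz _), hann _ (hsub a),
      hann _ (hz _)] at h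
    simpa using h
  rw [sub_mul, map_sub, map_sub, sub_mul, mul_assoc, hea', hea', mul_assoc] at h1
  exact sub_left_injective h1

/-- Let `A` be a complex Banach algebra with a right identity `e` such that
the subalgebra `eA` is commutative and semisimple (its Jacobson radical is zero).  If `d₁`
and `d₂` are two Jordan derivations of `A`, then the composition `d₁ ∘ d₂` is a
derivation of `A`. -/
theorem comp_of_jordanDerivations_is_derivation
    {A : Type*} [NonUnitalNormedRing A] [NormedSpace ℂ A]
    [IsScalarTower ℂ A A] [SMulCommClass ℂ A A] [CompleteSpace A]
    (e : A) (he : ∀ a : A, a * e = a)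
    (hcomm : ∀ a b : A, (e * a) * (e * b) = (e * b) * (e * a))
    (hss : letI : Ring (eSub e) := eRing e he
           (⊥ : Ideal (eSub e)).jacobson = ⊥)
    (d₁ d₂ : A →ₗ[ℂ] A)
    (hd₁ : ∀ a : A, d₁ (a * a) = d₁ a * a + a * d₁ a)
    (hd₂ : ∀ a : A, d₂ (a * a) = d₂ a * a + a * d₂ a) :
    ∀ a x : A, d₁ (d₂ (a * x)) = d₁ (d₂ a) * x + a * d₁ (d₂ x) := by
  obtain ⟨h1, h1'⟩ := jd_structure e he hcomm hss d₁ hd₁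
  obtain ⟨_, h2'⟩ := jd_structure e he hcomm hss d₂ hd₂
  intro a x
  have h3 : a * d₁ (d₂ x) = 0 := by
    rw [← he a, mul_assoc, h1, mul_zero]
  rw [h2', h1', h3, add_zero]
end
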